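/- Let k be a triangular number divisible by 4. Then for every natural number n with 2^k - 2^{k/2} < n ≤ 2^k - 2^{k/2} + k/4, the triangular number t_n is not very triangular. -/

import Mathlib

/-- The n-th triangular number. -/
def triangular (n : ℕ) : ℕ := n * (n + 1) / 2

/-- A natural number is triangular if it is `triangular n` for some `n`. -/
def IsTriangular (m : ℕ) : Prop := ∃ n : ℕ, triangular n = m

/-- The number of 1s in the binary representation of `m` (binary digit sum). -/
def binOnes (m : ℕ) : ℕ := (Nat.digits 2 m).sum

/-- A number is very triangular if it is triangular and its binary digit sum is triangular. -/
def IsVeryTriangular (m : ℕ) : Prop := IsTriangular m ∧ IsTriangular (binOnes m)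

theorem binOnes_two_mul (m : ℕ) : binOnes (2 * m) = binOnes m := by
  rcases Nat.eq_zero_or_pos m with rfl | hm
  · rfl
  · unfold binOnes
    rw [Nat.digits_def' (by norm_num) (by omega)]
    simp

theorem binOnes_two_mul_add_one (m : ℕ) : binOnes (2 * m + 1) = binOnes m + 1 := by
  unfold binOnes
  rw [Nat.digits_def' (by norm_num) (by omega), show (2 * m + 1) % 2 = 1 by omega,
    show (2 * m + 1) / 2 = m by omega, List.sum_cons, add_comm]

theorem binOnes_pos {m : ℕ} (hm : 0 < m) : 0 < binOnes m := by
  induction m using Nat.strong_induction_on with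
  | _ m ih =>
    obtain ⟨j, rfl | rfl⟩ : ∃ j, m = 2 * j ∨ m = 2 * j + 1 := ⟨m / 2, by omega⟩
    · rw [binOnes_two_mul]
      exact ih j (by omega) (by omega)
    · rw [binOnes_two_mul_add_one]
      omega

theorem binOnes_two_pow_mul_add (h x y : ℕ) (hy : y < 2 ^ h) :
    binOnes (2 ^ h * x + y) = binOnes x + binOnes y := by
  induction h generalizing y with
  | zero =>
    obtain rfl : y = 0 := by simpa using hy
    simp [binOnes]
  | succ h ih =>
    rw [pow_succ] at hy
    obtain ⟨j, rfl | rfl⟩ : ∃ j, y = 2 * j ∨ y = 2 * j + 1 := ⟨y / 2, by omega⟩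
    · rw [show 2 ^ (h + 1) * x + 2 * j = 2 * (2 ^ h * x + j) by ring, binOnes_two_mul,
        binOnes_two_mul, ih j (by omega)]
    · rw [show 2 ^ (h + 1) * x + (2 * j + 1) = 2 * (2 ^ h * x + j) + 1 by ring,
        binOnes_two_mul_add_one, binOnes_two_mul_add_one, ih j (by omega), add_assoc]

/-- Complementary `h`-bit numbers have `h` ones in total. -/
theorem binOnes_add_binOnes (h x y : ℕ) (hxy : x + y + 1 = 2 ^ h) :
    binOnes x + binOnes y = h := by
  induction h generalizing x y with
  | zero =>
    rw [pow_zero] at hxy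
    obtain ⟨rfl, rfl⟩ : x = 0 ∧ y = 0 := by omega
    simp [binOnes]
  | succ h ih =>
    rw [pow_succ] at hxy
    obtain ⟨i, rfl | rfl⟩ : ∃ i, x = 2 * i ∨ x = 2 * i + 1 := ⟨x / 2, by omega⟩
    · obtain ⟨j, rfl⟩ : ∃ j, y = 2 * j + 1 := ⟨y / 2, by omega⟩
      rw [binOnes_two_mul, binOnes_two_mul_add_one, ← ih i j (by omega), add_assoc]
    · obtain ⟨j, rfl⟩ : ∃ j, y = 2 * j := ⟨y / 2, by omega⟩
      rw [binOnes_two_mul, binOnes_two_mul_add_one, ← ih i j (by omega)]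
      ring

theorem binOnes_le_of_lt_two_pow {h x : ℕ} (hx : x < 2 ^ h) : binOnes x ≤ h := by
  have := binOnes_add_binOnes h x (2 ^ h - 1 - x) (by omega)
  omega

theorem two_mul_triangular (n : ℕ) : 2 * triangular n = n * (n + 1) :=
  Nat.mul_div_cancel' (Nat.even_mul_succ_self n).two_dvd

theorem triangular_mono : Monotone triangular := fun _ _ h =>
  Nat.div_le_div_right (Nat.mul_le_mul h (by omega))

theorem triangular_succ (n : ℕ) : triangular (n + 1) = triangular n + (n + 1) := by
  have h₁ := two_mul_triangular n
  have h₂ := two_mul_triangular (n + 1)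
  nlinarith

theorem not_isTriangular_of_lt_of_lt {a m : ℕ} (h₁ : triangular a < m)
    (h₂ : m < triangular (a + 1)) : ¬ IsTriangular m := by
  rintro ⟨b, rfl⟩
  have h₃ := triangular_mono.reflect_lt h₁
  have h₄ := triangular_mono.reflect_lt h₂
  omega

/-- With `h = p + 1`, the binary digit sum of the triangular number of index
`2 ^ (2 * h) - 2 ^ h + r` is `2 * h` plus that of `triangular r`. -/
theorem binOnes_triangular (p r n : ℕ) (hr : r < 2 ^ (p + 1)) (ht : triangular r < 2 ^ p)
    (hn : n + 2 ^ (p + 1) = 2 ^ (2 * (p + 1)) + r) :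
    binOnes (triangular n) = 2 * (p + 1) + binOnes (triangular r) := by
  obtain ⟨d, hd⟩ : ∃ d, 2 ^ p = d + 1 := ⟨2 ^ p - 1, by have := Nat.two_pow_pos p; omega⟩
  obtain ⟨c, hc⟩ : ∃ c, c + 2 * r + 1 = 2 ^ (p + 2) := by
    refine ⟨2 ^ (p + 2) - (2 * r + 1), ?_⟩
    rw [pow_succ 2 (p + 1)]
    omega
  have hsq : 2 ^ (2 * (p + 1)) = 4 * (2 ^ p * 2 ^ p) := by ring
  have key : triangular n =
      2 ^ (2 * (p + 1)) * (2 ^ (p + 1) * d + r) + (2 ^ p * c + triangular r) := by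
    have e₁ := two_mul_triangular n
    have e₂ := two_mul_triangular r
    have hc' := hc
    have hn' := hn
    rw [hsq, pow_succ] at hn'
    rw [show 2 ^ (p + 2) = 4 * 2 ^ p by ring] at hc'
    rw [hsq, pow_succ]
    generalize 2 ^ p = M at *
    zify at *
    have hd' : (d : ℤ) = M - 1 := by linarith
    have hc'' : (c : ℤ) = 4 * M - 1 - 2 * r := by linarith
    have hn'' : (n : ℤ) = 4 * (M * M) + r - M * 2 := by linarith
    rw [hn''] at e₁
    rw [hc'', hd']
    linarith
  have hlt : 2 ^ p * c + triangular r < 2 ^ (2 * (p + 1)) := by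
    rw [hsq]
    have : c + 1 ≤ 4 * 2 ^ p := by rw [show 4 * 2 ^ p = 2 ^ (p + 2) by ring]; omega
    nlinarith [Nat.mul_le_mul_left (2 ^ p) this]
  have h₁ := binOnes_add_binOnes p d 0 (by omega)
  have h₂ := binOnes_add_binOnes (p + 2) c (2 * r) hc
  have h₃ : binOnes 0 = 0 := by simp [binOnes]
  rw [binOnes_two_mul] at h₂
  rw [key, binOnes_two_pow_mul_add _ _ _ hlt, binOnes_two_pow_mul_add _ _ _ hr,
    binOnes_two_pow_mul_add _ _ _ ht]
  omega

theorem mul_mul_lt_two_pow {a : ℕ} (ha : 7 ≤ a) :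
    a * (a + 1) * (a * (a + 1) + 8) < 128 * 2 ^ a := by
  induction a, ha using Nat.le_induction with
  | base => norm_num
  | succ a ha ih =>
    rw [pow_succ]
    obtain ⟨b, rfl⟩ := Nat.exists_eq_add_of_le ha
    nlinarith [Nat.zero_le b, Nat.zero_le (b ^ 2), Nat.zero_le (b ^ 3), Nat.zero_le (b ^ 4)]

theorem stmt15 (k : ℕ) (hk : IsTriangular k) (h4 : 4 ∣ k) (n : ℕ)
    (h1 : 2 ^ k - 2 ^ (k / 2) < n) (h2 : n ≤ 2 ^ k - 2 ^ (k / 2) + k / 4) :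
    ¬ IsVeryTriangular (triangular n) := by
  obtain ⟨a, rfl⟩ := hk
  obtain ⟨q, hq⟩ := h4
  have hq₀ : 0 < q := by omega
  have haq : a * (a + 1) = 8 * q := by rw [← two_mul_triangular, hq]; ring
  have ha : 7 ≤ a := by
    by_contra! h
    interval_cases a <;> omega
  obtain ⟨p, rfl | rfl⟩ : ∃ p, q = 0 ∨ q = p + 1 := ⟨q - 1, by omega⟩
  · omega
  have hle : 2 ^ (triangular a / 2) ≤ 2 ^ triangular a :=
    Nat.pow_le_pow_right (by norm_num) (by omega)
  obtain ⟨r, hr⟩ : ∃ r, n + 2 ^ (triangular a / 2) = 2 ^ triangular a + r :=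
    ⟨n + 2 ^ (triangular a / 2) - 2 ^ triangular a, by omega⟩
  have hr₀ : 0 < r := by omega
  have hrq : r ≤ p + 1 := by omega
  have htr : triangular r < 2 ^ a := by
    refine (triangular_mono hrq).trans_lt ?_
    have h₁ := two_mul_triangular (p + 1)
    have h₂ := mul_mul_lt_two_pow ha
    rw [haq] at h₂
    nlinarith
  have hap : a ≤ 2 * p + 1 := by nlinarith
  have htp : triangular r < 2 ^ (2 * p + 1) :=
    htr.trans_le (Nat.pow_le_pow_right (by norm_num) hap)
  have hrp : r < 2 ^ (2 * p + 1 + 1) :=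
    lt_of_le_of_lt (by omega) Nat.lt_two_pow_self
  have hones := binOnes_triangular (2 * p + 1) r n hrp htp (by
    rw [hq, show 4 * (p + 1) / 2 = 2 * p + 1 + 1 by omega] at hr
    rw [hr]
    ring)
  have htpos : 0 < triangular r := by
    have := two_mul_triangular r
    nlinarith
  have hpos := binOnes_pos htpos
  have hupper := binOnes_le_of_lt_two_pow htr
  rintro ⟨-, h⟩
  refine not_isTriangular_of_lt_of_lt (a := a) ?_ ?_ h
  · omega
  · rw [triangular_succ]
    omega
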